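/- Let N ≥ 1 and let R = ℂ[a_{ij} : 1 ≤ i < j ≤ N] be a polynomial ring. Let X be the generic N×N skew-symmetric matrix over R, i.e. X_{ij} = a_{ij} and X_{ji} = −a_{ij} for i < j, and X_{ii} = 0. Let Ī ⊆ R be the ideal generated by the determinants of all 3×3 submatrices of X (obtained by choosing any 3 rows and any 3 columns). Then the radical of Ī equals the ideal of R generated by the 4×4 sub-Pfaffians Pf_{ijkl} := a_{ij}a_{kl} − a_{ik}a_{jl} + a_{il}a_{jk} for all 1 ≤ i < j < k < l ≤ N (this generating set is empty, so the radical is the zero ideal, when N < 4). -/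

import Mathlib

open Matrix

/-- The generic `N × N` skew-symmetric matrix, with entries the polynomial variables
`a_{ij}` for `i < j`, `-a_{ji}` for `j < i`, and `0` on the diagonal. -/
noncomputable def genSkew (N : ℕ) :
    Matrix (Fin N) (Fin N) (MvPolynomial {p : Fin N × Fin N // p.1 < p.2} ℂ) :=
  Matrix.of fun i j =>
    if h : i < j then MvPolynomial.X ⟨(i, j), h⟩
    else if h' : j < i then - MvPolynomial.X ⟨(j, i), h'⟩
    else 0

open MvPolynomial MonomialOrder in
/-- The parametrization `a_{ij} ↦ x_i y_j - x_j y_i` of skew-symmetric matrices of rank `≤ 2`. -/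
noncomputable def rankTwoParam (N : ℕ) :
    MvPolynomial {p : Fin N × Fin N // p.1 < p.2} ℂ →ₐ[ℂ] MvPolynomial (Fin N ⊕ₗ Fin N) ℂ :=
  MvPolynomial.aeval fun p =>
    X (Sum.inlₗ p.1.1) * X (Sum.inrₗ p.1.2) - X (Sum.inlₗ p.1.2) * X (Sum.inrₗ p.1.1)

/-- The ideal generated by the `4 × 4` sub-Pfaffians of the generic skew-symmetric matrix. -/
noncomputable def pfaffianIdeal (N : ℕ) :
    Ideal (MvPolynomial {p : Fin N × Fin N // p.1 < p.2} ℂ) :=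
  Ideal.span {p : MvPolynomial {p : Fin N × Fin N // p.1 < p.2} ℂ |
    ∃ i j k l : Fin N, i < j ∧ j < k ∧ k < l ∧
      p = genSkew N i j * genSkew N k l - genSkew N i k * genSkew N j l
          + genSkew N i l * genSkew N j k}

/-- Exponents of monomials in the `a_{ij}` in which no interval `[i, j]` is nested strictly inside
another one. -/
def NonNesting {N : ℕ} (m : {p : Fin N × Fin N // p.1 < p.2} →₀ ℕ) : Prop :=
  ∀ p ∈ m.support, ∀ q ∈ m.support, p.1.1 < q.1.1 → p.1.2 ≤ q.1.2

/-- The exponent of `∏ x_i y_j` over the factors `a_{ij}` of a monomial. -/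
noncomputable def leadExponent (N : ℕ) :
    ({p : Fin N × Fin N // p.1 < p.2} →₀ ℕ) →+ (Fin N ⊕ₗ Fin N →₀ ℕ) :=
  Finsupp.weight fun p =>
    Finsupp.single (Sum.inlₗ p.1.1) 1 + Finsupp.single (Sum.inrₗ p.1.2) 1

/-- The sum of the squared lengths of the intervals in a monomial. -/
noncomputable def squaredLength (N : ℕ) :
    ({p : Fin N × Fin N // p.1 < p.2} →₀ ℕ) →+ ℕ :=
  Finsupp.weight fun p => ((p.1.2 : ℕ) - (p.1.1 : ℕ)) ^ 2

section genSkew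

variable {N : ℕ}

theorem genSkew_of_lt {i j : Fin N} (h : i < j) :
    genSkew N i j = MvPolynomial.X ⟨(i, j), h⟩ := by
  simp [genSkew, h]

theorem genSkew_self (i : Fin N) : genSkew N i i = 0 := by
  simp [genSkew]

theorem genSkew_swap (i j : Fin N) : genSkew N i j = -genSkew N j i := by
  rcases lt_trichotomy i j with h | rfl | h
  · simp [genSkew, h, h.not_gt]
  · simp [genSkew_self]
  · simp [genSkew, h, h.not_gt]

open MvPolynomial in
theorem rankTwoParam_genSkew (i j : Fin N) :
    rankTwoParam N (genSkew N i j) =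
      X (Sum.inlₗ i) * X (Sum.inrₗ j) - X (Sum.inlₗ j) * X (Sum.inrₗ i) := by
  rcases lt_trichotomy i j with h | rfl | h
  · simp [genSkew_of_lt h, rankTwoParam]
  · simp [genSkew_self]
  · simp [genSkew_swap i j, genSkew_of_lt h, rankTwoParam]

theorem rankTwoParam_det_three (r c : Fin 3 → Fin N) :
    rankTwoParam N ((genSkew N).submatrix r c).det = 0 := by
  simp only [Matrix.det_fin_three, Matrix.submatrix_apply, map_add, map_sub, map_mul,
    rankTwoParam_genSkew]
  ring

theorem det_four_genSkew (i j k l : Fin N) :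
    ((genSkew N).submatrix ![i, j, k, l] ![i, j, k, l]).det =
      (genSkew N i j * genSkew N k l - genSkew N i k * genSkew N j l
        + genSkew N i l * genSkew N j k) ^ 2 := by
  simp only [Matrix.det_succ_row_zero (n := 3), Fin.sum_univ_four, Matrix.det_fin_three,
    Matrix.submatrix_apply]
  simp [Fin.succAbove, genSkew_self, genSkew_swap j i, genSkew_swap k i, genSkew_swap l i,
    genSkew_swap k j, genSkew_swap l j, genSkew_swap l k]
  ring

end genSkew

namespace NonNesting

variable {N : ℕ} {m m' : {p : Fin N × Fin N // p.1 < p.2} →₀ ℕ}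

theorem exists_least (hm : NonNesting m) (h0 : m ≠ 0) :
    ∃ p ∈ m.support, ∀ q ∈ m.support, p.1.1 ≤ q.1.1 ∧ p.1.2 ≤ q.1.2 := by
  obtain ⟨p, hp, hmin⟩ := m.support.exists_min_image
    (fun p => toLex (p.1.1, p.1.2)) (Finsupp.support_nonempty_iff.2 h0)
  refine ⟨p, hp, fun q hq => ?_⟩
  rcases Prod.Lex.toLex_le_toLex.1 (hmin q hq) with h | ⟨h, h'⟩
  · exact ⟨h.le, hm p hp q hq h⟩
  · exact ⟨h.le, h'⟩

theorem of_add_left {a : {p : Fin N × Fin N // p.1 < p.2} →₀ ℕ} (h : NonNesting (a + m)) :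
    NonNesting m := by
  have hs : ∀ p ∈ m.support, p ∈ (a + m).support := fun p hp => by
    simp only [Finsupp.mem_support_iff, Finsupp.add_apply] at hp ⊢
    omega
  exact fun p hp q hq => h p (hs p hp) q (hs q hq)

end NonNesting

section leadExponent

variable {N : ℕ} {m : {p : Fin N × Fin N // p.1 < p.2} →₀ ℕ}

theorem leadExponent_single (p : {p : Fin N × Fin N // p.1 < p.2}) (n : ℕ) :
    leadExponent N (Finsupp.single p n) =
      n • (Finsupp.single (Sum.inlₗ p.1.1) 1 + Finsupp.single (Sum.inrₗ p.1.2) 1) :=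
  Finsupp.weight_single _ _ _

theorem leadExponent_apply (s : Fin N ⊕ₗ Fin N) :
    leadExponent N m s = ∑ p ∈ m.support,
      m p * ((Finsupp.single (Sum.inlₗ p.1.1) 1 + Finsupp.single (Sum.inrₗ p.1.2) 1 :
        Fin N ⊕ₗ Fin N →₀ ℕ) s) := by
  simp only [leadExponent, Finsupp.weight_apply, Finsupp.sum, Finsupp.finsetSum_apply,
    Finsupp.smul_apply, smul_eq_mul]

theorem leadExponent_inl_ne_zero (i : Fin N) :
    leadExponent N m (Sum.inlₗ i) ≠ 0 ↔ ∃ p ∈ m.support, p.1.1 = i := by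
  simp only [leadExponent_apply, ne_eq, Finset.sum_eq_zero_iff, not_forall, exists_prop]
  refine exists_congr fun p => and_congr_right fun hp => ?_
  simp [Finsupp.single_apply, Finsupp.mem_support_iff.1 hp]

theorem leadExponent_inr_ne_zero (i : Fin N) :
    leadExponent N m (Sum.inrₗ i) ≠ 0 ↔ ∃ p ∈ m.support, p.1.2 = i := by
  simp only [leadExponent_apply, ne_eq, Finset.sum_eq_zero_iff, not_forall, exists_prop]
  refine exists_congr fun p => and_congr_right fun hp => ?_
  simp [Finsupp.single_apply, Finsupp.mem_support_iff.1 hp]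

theorem leadExponent_eq_zero (h : leadExponent N m = 0) : m = 0 := by
  by_contra h0
  obtain ⟨p, hp⟩ := Finsupp.support_nonempty_iff.2 h0
  exact (leadExponent_inl_ne_zero p.1.1).2 ⟨p, hp, rfl⟩ (by simp [h])

theorem leadExponent_injOn : Set.InjOn (leadExponent N) {m | NonNesting m} := by
  intro m hm
  induction hd : m.degree generalizing m with
  | zero =>
    intro m' _ h
    obtain rfl := (Finsupp.degree_eq_zero_iff m).1 hd
    exact (leadExponent_eq_zero (by simpa using h.symm)).symm
  | succ d ih =>
    intro m' hm' h
    have h0 : m ≠ 0 := by rintro rfl; simp at hd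
    have h0' : m' ≠ 0 := by
      rintro rfl
      exact h0 (leadExponent_eq_zero (by simpa using h))
    obtain ⟨p, hp, hmin⟩ := hm.exists_least h0
    obtain ⟨p', hp', hmin'⟩ := NonNesting.exists_least hm' h0'
    have hpp : p = p' := by
      refine Subtype.ext (Prod.ext (le_antisymm ?_ ?_) (le_antisymm ?_ ?_))
      · have := (leadExponent_inl_ne_zero p'.1.1).2 ⟨p', hp', rfl⟩
        rw [← h] at this
        obtain ⟨q, hq, e⟩ := (leadExponent_inl_ne_zero _).1 this
        exact e ▸ (hmin q hq).1
      · have := (leadExponent_inl_ne_zero p.1.1).2 ⟨p, hp, rfl⟩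
        rw [h] at this
        obtain ⟨q, hq, e⟩ := (leadExponent_inl_ne_zero _).1 this
        exact e ▸ (hmin' q hq).1
      · have := (leadExponent_inr_ne_zero p'.1.2).2 ⟨p', hp', rfl⟩
        rw [← h] at this
        obtain ⟨q, hq, e⟩ := (leadExponent_inr_ne_zero _).1 this
        exact e ▸ (hmin q hq).2
      · have := (leadExponent_inr_ne_zero p.1.2).2 ⟨p, hp, rfl⟩
        rw [h] at this
        obtain ⟨q, hq, e⟩ := (leadExponent_inr_ne_zero _).1 this
        exact e ▸ (hmin' q hq).2
    subst hpp
    have le_of_mem : ∀ n : {p : Fin N × Fin N // p.1 < p.2} →₀ ℕ, p ∈ n.support →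
        Finsupp.single p 1 ≤ n := fun n hn =>
      Finsupp.single_le_iff.2 (Nat.one_le_iff_ne_zero.2 (Finsupp.mem_support_iff.1 hn))
    obtain ⟨a, rfl⟩ := exists_add_of_le (le_of_mem m hp)
    obtain ⟨b, rfl⟩ := exists_add_of_le (le_of_mem m' hp')
    rw [map_add, Finsupp.degree_single] at hd
    rw [map_add, map_add] at h
    rw [ih (NonNesting.of_add_left hm) (by omega) (NonNesting.of_add_left hm') (add_left_cancel h)]

open MvPolynomial MonomialOrder in
theorem monic_rankTwoParam_X (p : {p : Fin N × Fin N // p.1 < p.2}) :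
    MonomialOrder.lex.degree (rankTwoParam N (X p)) = leadExponent N (Finsupp.single p 1) ∧
      MonomialOrder.lex.Monic (rankTwoParam N (X p)) := by
  obtain ⟨⟨i, j⟩, h⟩ := p
  have key : ∀ a b : Fin N, (X (Sum.inlₗ a) * X (Sum.inrₗ b) : MvPolynomial (Fin N ⊕ₗ Fin N) ℂ) =
      monomial (Finsupp.single (Sum.inlₗ a) 1 + Finsupp.single (Sum.inrₗ b) 1) 1 := fun a b => by
    simp [X, monomial_mul]
  have hlt : MonomialOrder.lex.degree
        (X (Sum.inlₗ j) * X (Sum.inrₗ i) : MvPolynomial (Fin N ⊕ₗ Fin N) ℂ) ≺[MonomialOrder.lex]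
      MonomialOrder.lex.degree
        (X (Sum.inlₗ i) * X (Sum.inrₗ j) : MvPolynomial (Fin N ⊕ₗ Fin N) ℂ) := by
    classical
    rw [key, key, degree_monomial, degree_monomial, if_neg one_ne_zero, if_neg one_ne_zero,
      MonomialOrder.lex_lt_iff, Finsupp.Lex.lt_iff]
    refine ⟨Sum.inlₗ i, fun s hs => ?_, ?_⟩
    · induction s using Lex.rec with
      | h s =>
        rcases s with s | s
        · have hs : s < i := by simpa [Sum.inlₗ] using hs
          simp [Sum.inlₗ, Sum.inrₗ, hs.ne', (hs.trans h).ne']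
        · simp [Sum.inlₗ] at hs
    · simp [Sum.inlₗ, Sum.inrₗ, h.ne']
  have hX : rankTwoParam N (X ⟨(i, j), h⟩) =
      X (Sum.inlₗ i) * X (Sum.inrₗ j) - X (Sum.inlₗ j) * X (Sum.inrₗ i) := by
    simp [rankTwoParam]
  rw [hX]
  constructor
  · classical
    rw [degree_sub_of_lt hlt, key, degree_monomial, if_neg one_ne_zero, leadExponent_single,
      one_smul]
  · rw [MonomialOrder.Monic, leadingCoeff_sub_of_lt hlt, key]
    exact monic_monomial_one

open MvPolynomial MonomialOrder in
theorem monic_rankTwoParam_monomial (m : {p : Fin N × Fin N // p.1 < p.2} →₀ ℕ) :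
    MonomialOrder.lex.degree (rankTwoParam N (monomial m 1)) = leadExponent N m ∧
      MonomialOrder.lex.Monic (rankTwoParam N (monomial m 1)) := by
  induction m using Finsupp.induction_linear with
  | zero => simp [monic_one]
  | add a b ha hb =>
    have e : (monomial (a + b) 1 : MvPolynomial {p : Fin N × Fin N // p.1 < p.2} ℂ) =
        monomial a 1 * monomial b 1 := by simp [monomial_mul]
    rw [e, map_mul, map_add]
    exact ⟨by rw [degree_mul ha.2.ne_zero hb.2.ne_zero, ha.1, hb.1], ha.2.mul hb.2⟩
  | single p n =>
    obtain ⟨h₁, h₂⟩ := monic_rankTwoParam_X p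
    rw [← X_pow_eq_monomial, map_pow]
    refine ⟨?_, h₂.pow⟩
    rw [degree_pow, h₁, ← map_nsmul]
    simp

open MvPolynomial MonomialOrder in
theorem eq_zero_of_rankTwoParam_eq_zero {f : MvPolynomial {p : Fin N × Fin N // p.1 < p.2} ℂ}
    (hf : ∀ m ∈ f.support, NonNesting m) (h : rankTwoParam N f = 0) : f = 0 := by
  by_contra h0
  obtain ⟨m, hm, hmax⟩ := f.support.exists_max_image
    (fun m => MonomialOrder.lex.toSyn (leadExponent N m)) (MvPolynomial.support_nonempty.2 h0)
  have hsum : rankTwoParam N f =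
      ∑ n ∈ f.support, f.coeff n • rankTwoParam N (monomial n 1) := by
    conv_lhs => rw [f.as_sum, map_sum]
    refine Finset.sum_congr rfl fun n _ => ?_
    rw [← map_smul, smul_monomial, smul_eq_mul, mul_one]
  have hc : coeff (leadExponent N m) (rankTwoParam N f) = f.coeff m := by
    rw [hsum, coeff_sum, Finset.sum_eq_single_of_mem m hm]
    · rw [coeff_smul, ← (monic_rankTwoParam_monomial m).1,
        (monic_rankTwoParam_monomial m).2.coeff_degree, smul_eq_mul, mul_one]
    · intro n hn hne
      suffices hlt : leadExponent N n ≺[MonomialOrder.lex] leadExponent N m by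
        rw [← (monic_rankTwoParam_monomial n).1] at hlt
        rw [coeff_smul, coeff_eq_zero_of_lt hlt, smul_zero]
      refine (hmax n hn).lt_of_ne fun e => hne ?_
      exact leadExponent_injOn (hf n hn) (hf m hm) (MonomialOrder.lex.toSyn.injective e)
  rw [h, coeff_zero] at hc
  exact MvPolynomial.mem_support_iff.1 hm hc.symm

end leadExponent

section straightening

variable {N : ℕ}

open MvPolynomial

theorem X_mul_X_sub_mem_pfaffianIdeal {i j k l : Fin N} (hij : i < j) (hjk : j < k) (hkl : k < l) :
    (X ⟨(i, l), hij.trans (hjk.trans hkl)⟩ * X ⟨(j, k), hjk⟩ -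
      (X ⟨(i, k), hij.trans hjk⟩ * X ⟨(j, l), hjk.trans hkl⟩ - X ⟨(i, j), hij⟩ * X ⟨(k, l), hkl⟩) :
      MvPolynomial {p : Fin N × Fin N // p.1 < p.2} ℂ) ∈ pfaffianIdeal N := by
  refine Ideal.subset_span ⟨i, j, k, l, hij, hjk, hkl, ?_⟩
  rw [genSkew_of_lt hij, genSkew_of_lt hkl, genSkew_of_lt (hij.trans hjk),
    genSkew_of_lt (hjk.trans hkl), genSkew_of_lt (hij.trans (hjk.trans hkl)), genSkew_of_lt hjk]
  ring

/-- The straightening law. -/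
theorem monomial_mem_pfaffianIdeal_sup (m : {p : Fin N × Fin N // p.1 < p.2} →₀ ℕ) :
    (monomial m 1 : MvPolynomial {p : Fin N × Fin N // p.1 < p.2} ℂ) ∈
      (pfaffianIdeal N).restrictScalars ℂ ⊔ restrictSupport ℂ {m | NonNesting m} := by
  induction hd : squaredLength N m using Nat.strong_induction_on generalizing m with
  | _ d ih =>
  subst hd
  by_cases hm : NonNesting m
  · refine Submodule.mem_sup_right ?_
    rw [mem_restrictSupport_iff]
    exact (Finset.coe_subset.2 support_monomial_subset).trans (by simpa using hm)
  · simp only [NonNesting, not_forall, not_le] at hm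
    obtain ⟨⟨⟨i, l⟩, hil⟩, hp, ⟨⟨j, k⟩, hjk⟩, hq, hij, hkl⟩ := hm
    dsimp only at hij hkl hil hjk
    have hle : Finsupp.single ⟨(i, l), hil⟩ 1 + Finsupp.single ⟨(j, k), hjk⟩ 1 ≤ m := by
      intro s
      rw [Finsupp.mem_support_iff] at hp hq
      simp only [Finsupp.add_apply, Finsupp.single_apply]
      split_ifs with h₁ h₂ h₂
      · exact absurd (congrArg (fun t => t.1.1) (h₁.trans h₂.symm)) hij.ne
      · subst h₁; omega
      · subst h₂; omega
      · omega
    obtain ⟨n, rfl⟩ := exists_add_of_le hle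
    have e : ∀ p q : {p : Fin N × Fin N // p.1 < p.2},
        (monomial (Finsupp.single p 1 + Finsupp.single q 1 + n) 1 :
          MvPolynomial {p : Fin N × Fin N // p.1 < p.2} ℂ) = X p * X q * monomial n 1 := by
      intro p q
      simp [X, monomial_mul]
    have hlen : ∀ p q : {p : Fin N × Fin N // p.1 < p.2},
        squaredLength N (Finsupp.single p 1 + Finsupp.single q 1 + n) =
          ((p.1.2 : ℕ) - (p.1.1 : ℕ)) ^ 2 + ((q.1.2 : ℕ) - (q.1.1 : ℕ)) ^ 2
            + squaredLength N n := by
      intro p q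
      simp [squaredLength, Finsupp.weight_single]
    obtain ⟨a, ha⟩ := Nat.exists_eq_add_of_lt (Fin.lt_def.1 hij)
    obtain ⟨b, hb⟩ := Nat.exists_eq_add_of_lt (Fin.lt_def.1 hjk)
    obtain ⟨c, hc⟩ := Nat.exists_eq_add_of_lt (Fin.lt_def.1 hkl)
    have d₁ : (l : ℕ) - i = a + b + c + 3 := by omega
    have d₂ : (k : ℕ) - j = b + 1 := by omega
    have d₃ : (k : ℕ) - i = a + b + 2 := by omega
    have d₄ : (l : ℕ) - j = b + c + 2 := by omega
    have d₅ : (j : ℕ) - i = a + 1 := by omega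
    have d₆ : (l : ℕ) - k = c + 1 := by omega
    have h₁ := ih _ (by rw [hlen, hlen]; simp only [d₁, d₂, d₃, d₄]; nlinarith)
      (Finsupp.single ⟨(i, k), hij.trans hjk⟩ 1 + Finsupp.single ⟨(j, l), hjk.trans hkl⟩ 1 + n) rfl
    have h₂ := ih _ (by rw [hlen, hlen]; simp only [d₁, d₂, d₅, d₆]; nlinarith)
      (Finsupp.single ⟨(i, j), hij⟩ 1 + Finsupp.single ⟨(k, l), hkl⟩ 1 + n) rfl
    have h₃ : _ ∈ (pfaffianIdeal N).restrictScalars ℂ ⊔ restrictSupport ℂ {m | NonNesting m} :=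
      Submodule.mem_sup_left (Ideal.mul_mem_right (monomial n 1) _
        (X_mul_X_sub_mem_pfaffianIdeal hij hjk hkl))
    convert add_mem h₃ (sub_mem h₁ h₂) using 1
    rw [e, e, e]
    ring

theorem pfaffianIdeal_sup_restrictSupport :
    (pfaffianIdeal N).restrictScalars ℂ ⊔ restrictSupport ℂ {m | NonNesting m} = ⊤ := by
  refine eq_top_iff.2 fun f _ => ?_
  rw [f.as_sum]
  refine sum_mem fun m _ => ?_
  rw [← mul_one (coeff m f), ← smul_eq_mul, ← smul_monomial]
  exact Submodule.smul_mem _ _ (monomial_mem_pfaffianIdeal_sup m)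

theorem pfaffianIdeal_eq_ker (N : ℕ) : pfaffianIdeal N = RingHom.ker (rankTwoParam N) := by
  have hle : pfaffianIdeal N ≤ RingHom.ker (rankTwoParam N) := by
    refine Ideal.span_le.2 ?_
    rintro _ ⟨i, j, k, l, -, -, -, rfl⟩
    simp only [SetLike.mem_coe, RingHom.mem_ker, map_add, map_sub, map_mul, rankTwoParam_genSkew]
    ring
  refine le_antisymm hle fun f hf => ?_
  have hf' : f ∈ (pfaffianIdeal N).restrictScalars ℂ ⊔ restrictSupport ℂ {m | NonNesting m} := by
    simp [pfaffianIdeal_sup_restrictSupport]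
  obtain ⟨g, hg, r, hr, rfl⟩ := Submodule.mem_sup.1 hf'
  have hr0 : r = 0 := by
    refine eq_zero_of_rankTwoParam_eq_zero (fun m hm => (mem_restrictSupport_iff ℂ).1 hr hm) ?_
    have := hle hg
    rw [RingHom.mem_ker] at this hf
    rwa [map_add, this, zero_add] at hf
  simpa [hr0] using hg

end straightening

/-- The radical of the ideal generated by all `3 × 3` minors of the generic skew-symmetric
matrix equals the ideal generated by the `4 × 4` sub-Pfaffians
`Pf_{ijkl} = a_{ij} a_{kl} - a_{ik} a_{jl} + a_{il} a_{jk}`. -/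
theorem stmt_1 (N : ℕ) (hN : 1 ≤ N) :
    (Ideal.span {d : MvPolynomial {p : Fin N × Fin N // p.1 < p.2} ℂ |
        ∃ r c : Fin 3 → Fin N, d = ((genSkew N).submatrix r c).det}).radical
      = Ideal.span {p : MvPolynomial {p : Fin N × Fin N // p.1 < p.2} ℂ |
          ∃ i j k l : Fin N, i < j ∧ j < k ∧ k < l ∧
            p = genSkew N i j * genSkew N k l - genSkew N i k * genSkew N j l
                + genSkew N i l * genSkew N j k} := by
  change _ = pfaffianIdeal N
  apply le_antisymm
  · rw [pfaffianIdeal_eq_ker]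
    refine (RingHom.ker_isPrime (rankTwoParam N)).isRadical.radical_le_iff.2 (Ideal.span_le.2 ?_)
    rintro _ ⟨r, c, rfl⟩
    exact rankTwoParam_det_three r c
  · refine Ideal.span_le.2 ?_
    rintro _ ⟨i, j, k, l, -, -, -, rfl⟩
    refine ⟨2, ?_⟩
    rw [← det_four_genSkew, Matrix.det_succ_row_zero]
    refine sum_mem fun s _ => Ideal.mul_mem_left _ _ (Ideal.subset_span ?_)
    rw [Matrix.submatrix_submatrix]
    exact ⟨_, _, rfl⟩
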